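/- arXiv:1705.09904 — 2 statements merged into one kernel-verified Lean document; each statement's English description precedes it below -/
import Mathlib

section
/- For every τ in the complex upper half-plane ℍ and every z ∈ ℂ: Σ_{n∈ℤ} q^{n²/2} y^n = ∏_{n=1}^∞ (1−q^n)(1+q^{n−1/2}y)(1+q^{n−1/2}y^{−1}), i.e. the theta function θ₃(τ,z) admits the stated absolutely convergent product expansion. -/
open Complex Real

/-- The summand of the series defining the Jacobi theta function `θ₃`:
`q^(n²/2) * y^n` where `q = exp(2πiτ)`, `y = exp(2πiz)`. -/
noncomputable def theta3Term (τ z : ℂ) (n : ℤ) : ℂ :=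
  Complex.exp (π * I * (n : ℂ)^2 * τ) * Complex.exp (2 * π * I * (n : ℂ) * z)

/-- The `n`-th factor (for `n ≥ 1`, indexed by `n : ℕ` starting from `0`) of the triple
product: `(1-q^n)(1+q^(n-1/2)y)(1+q^(n-1/2)y⁻¹)`. -/
noncomputable def theta3ProdTerm (τ z : ℂ) (n : ℕ) : ℂ :=
  (1 - Complex.exp (2 * π * I * τ) ^ (n + 1)) *
  (1 + Complex.exp (2 * π * I * ((n : ℂ) + 1/2) * τ) * Complex.exp (2 * π * I * z)) *
  (1 + Complex.exp (2 * π * I * ((n : ℂ) + 1/2) * τ) * (Complex.exp (2 * π * I * z))⁻¹)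

open Filter Topology

section FiniteTripleProduct

variable {K : Type*} [Field K]

/-- The finite `q`-Pochhammer symbol `(q; q)_n = ∏_{k=1}^n (1 - q^k)`. -/
def qPoch (q : K) (n : ℕ) : K := ∏ k ∈ Finset.range n, (1 - q ^ (k + 1))

lemma qPoch_succ (q : K) (n : ℕ) : qPoch q (n + 1) = qPoch q n * (1 - q ^ (n + 1)) :=
  Finset.prod_range_succ _ _

lemma qPoch_ne_zero {q : K} (hq : ∀ k : ℕ, q ^ (k + 1) ≠ 1) (n : ℕ) : qPoch q n ≠ 0 :=
  Finset.prod_ne_zero_iff.mpr fun k _ ↦ sub_ne_zero.mpr (hq k).symm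

/-- The reciprocal `1 / (q; q)_m`, extended by `0` to negative integers `m`. -/
def invQPoch (q : K) (m : ℤ) : K := if m < 0 then 0 else (qPoch q m.toNat)⁻¹

lemma invQPoch_natCast (q : K) (n : ℕ) : invQPoch q n = (qPoch q n)⁻¹ := by
  simp [invQPoch]

lemma invQPoch_sub_one {q : K} (hq : ∀ k : ℕ, q ^ (k + 1) ≠ 1) (m : ℤ) :
    invQPoch q (m - 1) = (1 - q ^ m) * invQPoch q m := by
  rcases lt_trichotomy m 0 with hm | rfl | hm
  · simp [invQPoch, hm, show m - 1 < 0 by lia]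
  · simp [invQPoch]
  · obtain ⟨n, rfl⟩ : ∃ n : ℕ, m = (n + 1 : ℕ) := ⟨(m - 1).toNat, by lia⟩
    rw [show ((n + 1 : ℕ) : ℤ) - 1 = (n : ℕ) by push_cast; ring, invQPoch_natCast,
      invQPoch_natCast, qPoch_succ, zpow_natCast]
    have h₁ := qPoch_ne_zero hq n
    have h₂ : 1 - q ^ (n + 1) ≠ 0 := sub_ne_zero.mpr (hq n).symm
    field_simp

/-- The finite form of the Jacobi triple product identity. -/
lemma hasSum_finite_triple_product [TopologicalSpace K] [IsTopologicalRing K]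
    {x y : K} (hx : x ≠ 0) (hy : y ≠ 0) (hq : ∀ k : ℕ, (x ^ 2) ^ (k + 1) ≠ 1) (N : ℕ) :
    HasSum (fun n : ℤ ↦ qPoch (x ^ 2) (2 * N) * invQPoch (x ^ 2) (N + n) *
        invQPoch (x ^ 2) (N - n) * (x ^ (n ^ 2) * y ^ n))
      (∏ k ∈ Finset.range N, ((1 + x ^ (2 * k + 1) * y) * (1 + x ^ (2 * k + 1) * y⁻¹))) := by
  induction N with
  | zero =>
    rw [Finset.prod_range_zero]
    convert! hasSum_single (f := fun n : ℤ ↦ qPoch (x ^ 2) (2 * 0) *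
        invQPoch (x ^ 2) ((0 : ℕ) + n) * invQPoch (x ^ 2) ((0 : ℕ) - n) *
        (x ^ (n ^ 2) * y ^ n)) (0 : ℤ) fun n hn ↦ ?_ using 1
    · simp [qPoch, invQPoch]
    · rcases hn.lt_or_gt with h | h <;> simp [invQPoch, h]
  | succ N ih =>
    have hsub := (Equiv.subRight (1 : ℤ)).hasSum_iff.mpr ih
    have hadd := (Equiv.addRight (1 : ℤ)).hasSum_iff.mpr ih
    have key := ((ih.mul_left (1 + x ^ (4 * N + 2))).add
      (hsub.mul_left (x ^ (2 * N + 1) * y))).add (hadd.mul_left (x ^ (2 * N + 1) * y⁻¹))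
    rw [Finset.prod_range_succ]
    convert! key using 1
    · ext n
      have hq0 : x ^ 2 ≠ 0 := pow_ne_zero 2 hx
      simp only [Function.comp_apply, Equiv.subRight_apply, Equiv.coe_addRight]
      have e₁ : invQPoch (x ^ 2) (N + n) = (1 - (x ^ 2) ^ (N : ℤ) * (x ^ 2) * (x ^ 2) ^ n) *
          invQPoch (x ^ 2) (N + 1 + n) := by
        have := invQPoch_sub_one hq (N + 1 + n)
        rwa [show (N + 1 + n - 1 : ℤ) = N + n by ring, zpow_add₀ hq0, zpow_add_one₀ hq0] at this
      have e₂ : invQPoch (x ^ 2) (N - n) = (1 - (x ^ 2) ^ (N : ℤ) * (x ^ 2) / (x ^ 2) ^ n) *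
          invQPoch (x ^ 2) (N + 1 - n) := by
        have := invQPoch_sub_one hq (N + 1 - n)
        rwa [show (N + 1 - n - 1 : ℤ) = N - n by ring, zpow_sub₀ hq0, zpow_add_one₀ hq0] at this
      have e₃ : invQPoch (x ^ 2) (N + (n - 1)) = (1 - (x ^ 2) ^ (N : ℤ) * (x ^ 2) ^ n) *
          invQPoch (x ^ 2) (N + n) := by
        have := invQPoch_sub_one hq (N + n)
        rwa [show (N + n - 1 : ℤ) = N + (n - 1) by ring, zpow_add₀ hq0] at this
      have e₄ : invQPoch (x ^ 2) (N - (n + 1)) = (1 - (x ^ 2) ^ (N : ℤ) / (x ^ 2) ^ n) *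
          invQPoch (x ^ 2) (N - n) := by
        have := invQPoch_sub_one hq (N - n)
        rwa [show (N - n - 1 : ℤ) = N - (n + 1) by ring, zpow_sub₀ hq0] at this
      have t₁ : x ^ ((n - 1) ^ 2) * y ^ (n - 1) =
          x ^ (n ^ 2) * y ^ n * x / ((x ^ 2) ^ n * y) := by
        rw [show (n - 1) ^ 2 = n ^ 2 + 1 - 2 * n by ring, zpow_sub₀ hx, zpow_add_one₀ hx,
          zpow_sub_one₀ hy, zpow_mul, zpow_ofNat]
        field_simp
      have t₂ : x ^ ((n + 1) ^ 2) * y ^ (n + 1) =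
          x ^ (n ^ 2) * y ^ n * x * ((x ^ 2) ^ n * y) := by
        rw [show (n + 1) ^ 2 = n ^ 2 + 1 + 2 * n by ring, zpow_add₀ hx, zpow_add_one₀ hx,
          zpow_add_one₀ hy, zpow_mul, zpow_ofNat]
        ring
      rw [show (N : ℤ) - (n - 1) = N + 1 - n by ring, show (N : ℤ) + (n + 1) = N + 1 + n by ring,
        e₃, e₄, e₁, e₂, t₁, t₂, show 2 * (N + 1) = 2 * N + 1 + 1 by ring, qPoch_succ, qPoch_succ]
      push_cast
      have hs : (x ^ 2) ^ n ≠ 0 := zpow_ne_zero n hq0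
      generalize (x ^ 2) ^ n = s at *
      generalize x ^ (n ^ 2) * y ^ n = T
      rw [zpow_natCast]
      field_simp
      ring
    · linear_combination (∏ k ∈ Finset.range N,
        ((1 + x ^ (2 * k + 1) * y) * (1 + x ^ (2 * k + 1) * y⁻¹))) * x ^ (4 * N + 2) *
        mul_inv_cancel₀ hy

end FiniteTripleProduct

section Limit

variable {q : ℂ}

lemma pow_succ_ne_one_of_norm_lt_one (hq : ‖q‖ < 1) (k : ℕ) : q ^ (k + 1) ≠ 1 := by
  intro h
  have := pow_lt_one₀ (norm_nonneg q) hq k.succ_ne_zero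
  rw [← norm_pow, h, norm_one] at this
  exact this.false

lemma exists_tendsto_qPoch (hq : ‖q‖ < 1) : ∃ Q ≠ 0, Tendsto (qPoch q) atTop (𝓝 Q) := by
  have hs : Summable fun n : ℕ ↦ ‖-q ^ (n + 1)‖ := by
    simpa [pow_succ] using (summable_geometric_of_lt_one (norm_nonneg q) hq).mul_right ‖q‖
  refine ⟨∏' n : ℕ, (1 + -q ^ (n + 1)), tprod_one_add_ne_zero_of_summable (fun n ↦ ?_) hs, ?_⟩
  · rw [← sub_eq_add_neg]
    exact sub_ne_zero.mpr (pow_succ_ne_one_of_norm_lt_one hq n).symm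
  · simpa only [← sub_eq_add_neg] using!
      (multipliable_one_add_of_summable hs).hasProd.tendsto_prod_nat

lemma tendsto_invQPoch {Q : ℂ} (hQ : Q ≠ 0) (h : Tendsto (qPoch q) atTop (𝓝 Q)) :
    Tendsto (invQPoch q) atTop (𝓝 Q⁻¹) := by
  have hnat : Tendsto Int.toNat atTop atTop :=
    tendsto_atTop.mpr fun b ↦ (eventually_ge_atTop (b : ℤ)).mono fun m hm ↦ by lia
  refine ((h.inv₀ hQ).comp hnat).congr' ?_
  filter_upwards [eventually_ge_atTop 0] with m hm
  simp [invQPoch, hm.not_gt]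

lemma exists_norm_invQPoch_le {Q : ℂ} (hQ : Q ≠ 0) (h : Tendsto (qPoch q) atTop (𝓝 Q)) :
    ∃ B, ∀ m, ‖invQPoch q m‖ ≤ B := by
  obtain ⟨B, hB⟩ := (Metric.isBounded_range_of_tendsto _ (h.inv₀ hQ)).exists_norm_le
  refine ⟨B, fun m ↦ ?_⟩
  unfold invQPoch
  split_ifs
  · simpa using (norm_nonneg _).trans (hB _ ⟨0, rfl⟩)
  · exact hB _ ⟨_, rfl⟩

lemma tendsto_qPoch_mul_triple_product {x y : ℂ} (hx : x ≠ 0) (hy : y ≠ 0) (hx1 : ‖x‖ < 1)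
    (hs : Summable fun n : ℤ ↦ x ^ (n ^ 2) * y ^ n) :
    Tendsto (fun N ↦ qPoch (x ^ 2) N *
        ∏ k ∈ Finset.range N, ((1 + x ^ (2 * k + 1) * y) * (1 + x ^ (2 * k + 1) * y⁻¹)))
      atTop (𝓝 (∑' n : ℤ, x ^ (n ^ 2) * y ^ n)) := by
  have hq : ‖x ^ 2‖ < 1 := by
    rw [norm_pow]
    exact pow_lt_one₀ (norm_nonneg x) hx1 two_ne_zero
  obtain ⟨Q, hQ, hlim⟩ := exists_tendsto_qPoch hq
  obtain ⟨B, hB⟩ := exists_norm_invQPoch_le hQ hlim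
  obtain ⟨C, hC⟩ := (Metric.isBounded_range_of_tendsto _ hlim).exists_norm_le
  replace hC (n : ℕ) : ‖qPoch (x ^ 2) n‖ ≤ C := hC _ ⟨n, rfl⟩
  have hC0 : 0 ≤ C := (norm_nonneg _).trans (hC 0)
  have hB0 : 0 ≤ B := (norm_nonneg _).trans (hB 0)
  have hfin (N : ℕ) := ((hasSum_finite_triple_product hx hy
    (pow_succ_ne_one_of_norm_lt_one hq) N).mul_left (qPoch (x ^ 2) N)).tsum_eq
  simp_rw [← hfin]
  refine tendsto_tsum_of_dominated_convergence
    (bound := fun n : ℤ ↦ C * (C * B * B * ‖x ^ (n ^ 2) * y ^ n‖))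
    ((hs.norm.mul_left _).mul_left _) (fun n ↦ ?_) (.of_forall fun N n ↦ ?_)
  · have hdouble : Tendsto (fun N : ℕ ↦ 2 * N) atTop atTop :=
      tendsto_id.const_mul_atTop' two_pos
    have hplus : Tendsto (fun N : ℕ ↦ (N : ℤ) + n) atTop atTop :=
      tendsto_atTop_add_const_right _ _ tendsto_natCast_atTop_atTop
    have hminus : Tendsto (fun N : ℕ ↦ (N : ℤ) - n) atTop atTop :=
      tendsto_atTop_add_const_right _ _ tendsto_natCast_atTop_atTop
    have hinv := tendsto_invQPoch hQ hlim
    convert! hlim.mul ((((hlim.comp hdouble).mul (hinv.comp hplus)).mul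
      (hinv.comp hminus)).mul_const (x ^ (n ^ 2) * y ^ n)) using 2
    field_simp
  · simp only [norm_mul _ (_ * _ : ℂ), norm_mul (_ * _) (invQPoch _ _),
      norm_mul (qPoch _ _) (invQPoch _ _)]
    gcongr <;> first | exact hC _ | exact hB _

end Limit

lemma summable_norm_mul_sub_one {ι : Type*} {f g : ι → ℂ}
    (hf : Summable fun i ↦ ‖f i - 1‖) (hg : Summable fun i ↦ ‖g i - 1‖) :
    Summable fun i ↦ ‖f i * g i - 1‖ := by
  have hfg : Summable fun i ↦ ‖(f i - 1) * (g i - 1)‖ := by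
    simp_rw [norm_mul]
    exact hf.mul_of_nonneg hg (fun _ ↦ norm_nonneg _) (fun _ ↦ norm_nonneg _)
      |>.comp_injective (i := fun i ↦ (i, i)) fun _ _ h ↦ congrArg Prod.fst h
  refine ((hfg.add hf).add hg).of_nonneg_of_le (fun _ ↦ norm_nonneg _) fun i ↦ ?_
  rw [show f i * g i - 1 = (f i - 1) * (g i - 1) + (f i - 1) + (g i - 1) by ring]
  exact norm_add₃_le

lemma theta3Term_eq (τ z : ℂ) (n : ℤ) :
    theta3Term τ z n = cexp (π * I * τ) ^ (n ^ 2) * cexp (2 * π * I * z) ^ n := by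
  rw [theta3Term, ← Complex.exp_int_mul, ← Complex.exp_int_mul]
  push_cast
  ring_nf

lemma theta3ProdTerm_eq (τ z : ℂ) (n : ℕ) :
    theta3ProdTerm τ z n = (1 - (cexp (π * I * τ) ^ 2) ^ (n + 1)) *
      ((1 + cexp (π * I * τ) ^ (2 * n + 1) * cexp (2 * π * I * z)) *
      (1 + cexp (π * I * τ) ^ (2 * n + 1) * (cexp (2 * π * I * z))⁻¹)) := by
  have h₁ : cexp (2 * π * I * τ) = cexp (π * I * τ) ^ 2 := by
    rw [← Complex.exp_nat_mul]
    push_cast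
    ring_nf
  have h₂ : cexp (2 * π * I * ((n : ℂ) + 1 / 2) * τ) = cexp (π * I * τ) ^ (2 * n + 1) := by
    rw [← Complex.exp_nat_mul]
    push_cast
    ring_nf
  rw [theta3ProdTerm, h₁, h₂, mul_assoc]

lemma summable_theta3Term {τ : ℂ} (hτ : 0 < τ.im) (z : ℂ) : Summable (theta3Term τ z) := by
  refine ((summable_jacobiTheta₂_term_iff z τ).mpr hτ).congr fun n ↦ ?_
  rw [theta3Term, jacobiTheta₂_term, ← Complex.exp_add, add_comm]

lemma norm_exp_pi_mul_I_mul_lt_one {τ : ℂ} (hτ : 0 < τ.im) : ‖cexp (π * I * τ)‖ < 1 := by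
  rw [Complex.norm_exp, Real.exp_lt_one_iff]
  simpa using mul_pos Real.pi_pos hτ

lemma summable_norm_theta3ProdTerm_sub_one {τ : ℂ} (hτ : 0 < τ.im) (z : ℂ) :
    Summable fun n ↦ ‖theta3ProdTerm τ z n - 1‖ := by
  simp_rw [theta3ProdTerm_eq]
  have hx := norm_exp_pi_mul_I_mul_lt_one hτ
  generalize cexp (π * I * τ) = x at hx
  have hx2 : ‖x‖ ^ 2 < 1 := pow_lt_one₀ (norm_nonneg x) hx two_ne_zero
  have hgeom := summable_geometric_of_lt_one (by positivity) hx2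
  have hodd (w : ℂ) : Summable fun n : ℕ ↦ ‖1 + x ^ (2 * n + 1) * w - 1‖ := by
    simpa [pow_succ, pow_mul, mul_assoc] using hgeom.mul_right (‖x‖ * ‖w‖)
  refine summable_norm_mul_sub_one ?_
    (summable_norm_mul_sub_one (hodd _) (hodd _))
  simpa [pow_succ (x ^ 2)] using hgeom.mul_right (‖x‖ ^ 2)

/-- For every `τ ∈ ℍ` and `z ∈ ℂ`,
`θ₃(τ,z) = ∏_{n=1}^∞ (1-q^n)(1+q^(n-1/2)y)(1+q^(n-1/2)y⁻¹)`, the product being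
absolutely convergent. -/
theorem theta3_product_expansion (τ : UpperHalfPlane) (z : ℂ) :
    Summable (fun n : ℕ => ‖theta3ProdTerm (τ : ℂ) z n - 1‖) ∧
    Multipliable (fun n : ℕ => theta3ProdTerm (τ : ℂ) z n) ∧
    ∑' n : ℤ, theta3Term (τ : ℂ) z n = ∏' n : ℕ, theta3ProdTerm (τ : ℂ) z n := by
  have hsum := summable_norm_theta3ProdTerm_sub_one τ.im_pos z
  have hmul : Multipliable fun n : ℕ ↦ theta3ProdTerm (τ : ℂ) z n := by
    simpa using multipliable_one_add_of_summable hsum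
  refine ⟨hsum, hmul, ?_⟩
  refine tendsto_nhds_unique ?_ hmul.hasProd.tendsto_prod_nat
  have hs := summable_theta3Term τ.im_pos z
  simp_rw [funext (theta3Term_eq (τ : ℂ) z)] at hs ⊢
  refine (tendsto_qPoch_mul_triple_product (Complex.exp_ne_zero _) (Complex.exp_ne_zero _)
    (norm_exp_pi_mul_I_mul_lt_one τ.im_pos) hs).congr fun N ↦ ?_
  simp_rw [qPoch, ← Finset.prod_mul_distrib, theta3ProdTerm_eq]
end

section
/- For every τ in the complex upper half-plane ℍ and every z ∈ ℂ, the complex elliptic genus of a K3 surface is elliptic of index 1 in z with respect to the lattice ℤτ + ℤ: E_K3(τ, z+1) = E_K3(τ, z) and E_K3(τ, z+τ) = q^{−1} y^{−2} E_K3(τ, z). -/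
open Complex Real

/-- Jacobi theta function `θ₁(τ,z) = i Σ_{n∈ℤ} (-1)^n q^((n-1/2)²/2) y^(n-1/2)`. -/
noncomputable def theta1 (τ z : ℂ) : ℂ :=
  I * ∑' n : ℤ, (-1 : ℂ) ^ n * Complex.exp (π * I * ((n : ℂ) - 1/2)^2 * τ) *
    Complex.exp (2 * π * I * ((n : ℂ) - 1/2) * z)

/-- Jacobi theta function `θ₂(τ,z) = Σ_{n∈ℤ} q^((n-1/2)²/2) y^(n-1/2)`. -/
noncomputable def theta2 (τ z : ℂ) : ℂ :=
  ∑' n : ℤ, Complex.exp (π * I * ((n : ℂ) - 1/2)^2 * τ) *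
    Complex.exp (2 * π * I * ((n : ℂ) - 1/2) * z)

/-- Jacobi theta function `θ₃(τ,z) = Σ_{n∈ℤ} q^(n²/2) y^n`. -/
noncomputable def theta3 (τ z : ℂ) : ℂ :=
  ∑' n : ℤ, Complex.exp (π * I * (n : ℂ)^2 * τ) * Complex.exp (2 * π * I * (n : ℂ) * z)

/-- Jacobi theta function `θ₄(τ,z) = Σ_{n∈ℤ} (-1)^n q^(n²/2) y^n`. -/
noncomputable def theta4 (τ z : ℂ) : ℂ :=
  ∑' n : ℤ, (-1 : ℂ) ^ n * Complex.exp (π * I * (n : ℂ)^2 * τ) *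
    Complex.exp (2 * π * I * (n : ℂ) * z)

/-- Dedekind eta function `η(τ) = q^(1/24) ∏_{n=1}^∞ (1-q^n)`. -/
noncomputable def dedekindEta (τ : ℂ) : ℂ :=
  Complex.exp (2 * π * I * τ / 24) *
    ∏' n : ℕ, (1 - Complex.exp (2 * π * I * τ) ^ (n + 1))

/-- The Mordell function `h₃(τ) = (1/(η(τ)θ₃(τ,0))) Σ_{m∈ℤ} q^(m²/2-1/8)/(1+q^(m-1/2))`. -/
noncomputable def mordellH3 (τ : ℂ) : ℂ :=
  (1 / (dedekindEta τ * theta3 τ 0)) *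
    ∑' m : ℤ, Complex.exp (2 * π * I * ((m : ℂ)^2 / 2 - 1/8) * τ) /
      (1 + Complex.exp (2 * π * I * ((m : ℂ) - 1/2) * τ))

/-- The `N=4` vacuum character at central charge 6 (twisted Ramond sector):
`χ₀(τ,z) = -2(θ₃(τ,z)/θ₃(τ,0))² + (q^(-1/8)/η(τ) - 2h₃(τ))(θ₁(τ,z)/η(τ))²`. -/
noncomputable def chi0 (τ z : ℂ) : ℂ :=
  -2 * (theta3 τ z / theta3 τ 0)^2 +
    (Complex.exp (2 * π * I * (-1/8 : ℂ) * τ) / dedekindEta τ - 2 * mordellH3 τ) *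
      (theta1 τ z / dedekindEta τ)^2

/-- The massless matter `N=4` character at central charge 6:
`χ_mm(τ,z) = (θ₃(τ,z)/θ₃(τ,0))² + h₃(τ)(θ₁(τ,z)/η(τ))²`. -/
noncomputable def chimm (τ z : ℂ) : ℂ :=
  (theta3 τ z / theta3 τ 0)^2 + mordellH3 τ * (theta1 τ z / dedekindEta τ)^2

/-- The massive `N=4` character function at central charge 6:
`χ̂(τ,z) = (q^(-1/8)/η(τ))(θ₁(τ,z)/η(τ))²`. -/
noncomputable def chihat (τ z : ℂ) : ℂ :=
  (Complex.exp (2 * π * I * (-1/8 : ℂ) * τ) / dedekindEta τ) *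
    (theta1 τ z / dedekindEta τ)^2

/-- The complex elliptic genus of a K3 surface:
`E_K3(τ,z) = 8[(θ₂(τ,z)/θ₂(τ,0))² + (θ₃(τ,z)/θ₃(τ,0))² + (θ₄(τ,z)/θ₄(τ,0))²]`. -/
noncomputable def EK3 (τ z : ℂ) : ℂ :=
  8 * ((theta2 τ z / theta2 τ 0)^2 + (theta3 τ z / theta3 τ 0)^2 +
    (theta4 τ z / theta4 τ 0)^2)

theorem theta2_add_one (τ z : ℂ) : theta2 τ (z + 1) = -theta2 τ z := by
  unfold theta2
  rw [← tsum_neg]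
  refine tsum_congr fun n => ?_
  rw [show 2 * π * I * ((n : ℂ) - 1/2) * (z + 1) =
      2 * π * I * ((n : ℂ) - 1/2) * z + (n * (2 * π * I) - π * I) by ring, Complex.exp_add,
    Complex.exp_sub, Complex.exp_int_mul_two_pi_mul_I, Complex.exp_pi_mul_I]
  ring

theorem theta3_add_one (τ z : ℂ) : theta3 τ (z + 1) = theta3 τ z := by
  refine tsum_congr fun n => ?_
  rw [show 2 * π * I * (n : ℂ) * (z + 1) = 2 * π * I * (n : ℂ) * z + n * (2 * π * I) by ring,
    Complex.exp_add, Complex.exp_int_mul_two_pi_mul_I, mul_one]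

theorem theta4_add_one (τ z : ℂ) : theta4 τ (z + 1) = theta4 τ z := by
  refine tsum_congr fun n => ?_
  rw [show 2 * π * I * (n : ℂ) * (z + 1) = 2 * π * I * (n : ℂ) * z + n * (2 * π * I) by ring,
    Complex.exp_add, Complex.exp_int_mul_two_pi_mul_I, mul_one]

/-- Completing the square in the exponent of a theta series. -/
theorem exp_theta_add_tau (τ z m : ℂ) :
    Complex.exp (π * I * m ^ 2 * τ) * Complex.exp (2 * π * I * m * (z + τ)) =
      Complex.exp (-(π * I * (τ + 2 * z))) *
        (Complex.exp (π * I * (m + 1) ^ 2 * τ) * Complex.exp (2 * π * I * (m + 1) * z)) := by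
  simp only [← Complex.exp_add]
  ring_nf

theorem theta2_add_tau (τ z : ℂ) :
    theta2 τ (z + τ) = Complex.exp (-(π * I * (τ + 2 * z))) * theta2 τ z := by
  unfold theta2
  rw [← tsum_mul_left, ← (Equiv.addRight (1 : ℤ)).tsum_eq (fun n : ℤ =>
    Complex.exp (-(π * I * (τ + 2 * z))) * (Complex.exp (π * I * ((n : ℂ) - 1/2)^2 * τ) *
      Complex.exp (2 * π * I * ((n : ℂ) - 1/2) * z)))]
  refine tsum_congr fun n => ?_
  rw [exp_theta_add_tau, Equiv.coe_addRight, Int.cast_add, Int.cast_one, sub_add_eq_add_sub]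

theorem theta3_add_tau (τ z : ℂ) :
    theta3 τ (z + τ) = Complex.exp (-(π * I * (τ + 2 * z))) * theta3 τ z := by
  unfold theta3
  rw [← tsum_mul_left, ← (Equiv.addRight (1 : ℤ)).tsum_eq (fun n : ℤ =>
    Complex.exp (-(π * I * (τ + 2 * z))) * (Complex.exp (π * I * (n : ℂ)^2 * τ) *
      Complex.exp (2 * π * I * (n : ℂ) * z)))]
  refine tsum_congr fun n => ?_
  rw [exp_theta_add_tau, Equiv.coe_addRight, Int.cast_add, Int.cast_one]

theorem theta4_add_tau (τ z : ℂ) :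
    theta4 τ (z + τ) = -Complex.exp (-(π * I * (τ + 2 * z))) * theta4 τ z := by
  unfold theta4
  rw [← tsum_mul_left, ← (Equiv.addRight (1 : ℤ)).tsum_eq (fun n : ℤ =>
    -Complex.exp (-(π * I * (τ + 2 * z))) * ((-1 : ℂ) ^ n * Complex.exp (π * I * (n : ℂ)^2 * τ) *
      Complex.exp (2 * π * I * (n : ℂ) * z)))]
  refine tsum_congr fun n => ?_
  rw [mul_assoc, exp_theta_add_tau, Equiv.coe_addRight, Int.cast_add, Int.cast_one,
    zpow_add_one₀ (by norm_num)]
  ring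

/-- For every `τ ∈ ℍ` and `z ∈ ℂ`, the complex elliptic genus of a K3
surface is elliptic of index 1 in `z` with respect to `ℤτ + ℤ`:
`E_K3(τ, z+1) = E_K3(τ, z)` and `E_K3(τ, z+τ) = q⁻¹ y⁻² E_K3(τ, z)`. -/
theorem EK3_elliptic (τ : UpperHalfPlane) (z : ℂ) :
    EK3 (τ : ℂ) (z + 1) = EK3 (τ : ℂ) z ∧
    EK3 (τ : ℂ) (z + (τ : ℂ)) =
      (Complex.exp (2 * π * I * (τ : ℂ)))⁻¹ * ((Complex.exp (2 * π * I * z))^2)⁻¹ *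
        EK3 (τ : ℂ) z := by
  constructor
  · simp only [EK3, theta2_add_one, theta3_add_one, theta4_add_one, neg_div, neg_sq]
  · have h : (Complex.exp (2 * π * I * (τ : ℂ)))⁻¹ * ((Complex.exp (2 * π * I * z))^2)⁻¹ =
        Complex.exp (-(π * I * (τ + 2 * z))) ^ 2 := by
      simp only [← Complex.exp_nat_mul, ← Complex.exp_neg, ← Complex.exp_add]
      push_cast
      ring_nf
    rw [h, EK3, theta2_add_tau, theta3_add_tau, theta4_add_tau, EK3]
    ring
end
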